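/- Let M be a von Neumann algebra acting on a Hilbert space H, P ⊆ M a finite von Neumann subalgebra with a normal faithful conditional expectation E : M → P, and fix a normal semifinite faithful trace Tr on P whose restriction to the center Z(P) is semifinite. Let φ = Tr ∘ E. If (x_k) is a bounded net in M converging strongly to 0, then for every projection z ∈ Z(P) with Tr(z) < ∞, sup_{a ∈ (P)₁} φ(z a* x_k* x_k a z) → 0, where (P)₁ is the unit ball of P. -/

import Mathlib

open scoped ENNReal

namespace S19
open scoped InnerProductSpace
set_option linter.unusedSectionVars false
variable {H : Type*} [NormedAddCommGroup H] [InnerProductSpace ℂ H] [CompleteSpace H]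

lemma sp_one_add {S : H →L[ℂ] H} (hS : 0 ≤ S) : IsStrictlyPositive (1 + S) := by
  exact IsStrictlyPositive.add_nonneg (by simp) hS

lemma inv_mul {S : H →L[ℂ] H} (hS : 0 ≤ S) : Ring.inverse (1 + S) * (1 + S) = 1 :=
  Ring.inverse_mul_cancel _ (sp_one_add hS).isUnit

lemma mul_inv {S : H →L[ℂ] H} (hS : 0 ≤ S) : (1 + S) * Ring.inverse (1 + S) = 1 :=
  Ring.mul_inverse_cancel _ (sp_one_add hS).isUnit

lemma inv_nonneg {S : H →L[ℂ] H} (hS : 0 ≤ S) : 0 ≤ Ring.inverse (1 + S) := by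
  have h := sp_one_add hS
  obtain ⟨u, hu⟩ := h.isUnit
  rw [← hu, Ring.inverse_unit]
  exact CFC.inv_nonneg_of_nonneg u (by rw [hu]; exact h.nonneg)

lemma inv_anti {S T : H →L[ℂ] H} (hS : 0 ≤ S) (h : S ≤ T) :
    Ring.inverse (1 + T) ≤ Ring.inverse (1 + S) :=
  CStarAlgebra.antitoneOn_ringInverse (sp_one_add hS) (sp_one_add (hS.trans h)) (by gcongr)

lemma inv_ge {S : H →L[ℂ] H} (hS : 0 ≤ S) : 1 - S ≤ Ring.inverse (1 + S) := by
  rw [← sub_nonneg]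
  have h1 : 0 ≤ S * Ring.inverse (1 + S) * S := by
    have := star_left_conjugate_nonneg (inv_nonneg hS) S
    rwa [(IsSelfAdjoint.of_nonneg hS).star_eq] at this
  have h2 := inv_mul hS
  have h3 := mul_inv hS
  convert h1 using 1
  set R := Ring.inverse (1 + S)
  have e1 : R * S = 1 - R := by rw [mul_add, mul_one] at h2; rw [← h2]; abel
  have e2 : S * R = 1 - R := by rw [add_mul, one_mul] at h3; rw [← h3]; abel
  rw [e2, sub_mul, e1]; simp only [one_mul]; abel

lemma inv_le {S : H →L[ℂ] H} (hS : 0 ≤ S) (hS1 : S ≤ 1) :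
    Ring.inverse (1 + S) + (1/2 : ℝ) • S ≤ 1 := by
  have h2 := inv_mul hS
  have h3 := mul_inv hS
  have hc : Commute (Ring.inverse (1 + S)) S := by
    rw [mul_add, mul_one] at h2
    rw [add_mul, one_mul] at h3
    have := h2.trans h3.symm
    exact add_left_cancel this
  have p1 : 0 ≤ Ring.inverse (1 + S) * (S * (1 - S)) := by
    refine Commute.mul_nonneg (inv_nonneg hS) (Commute.mul_nonneg hS (sub_nonneg.2 hS1) ?_) ?_
    · exact (Commute.one_right _).sub_right (Commute.refl _)
    · exact hc.mul_right ((Commute.one_right _).sub_right hc)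
  have p2 : 0 ≤ (1/2 : ℝ) • (Ring.inverse (1 + S) * (S * (1 - S))) := smul_nonneg (by norm_num) p1
  rw [← sub_nonneg]
  convert p2 using 1
  set R := Ring.inverse (1 + S)
  have e1 : R * S = 1 - R := by rw [mul_add, mul_one] at h2; rw [← h2]; abel
  rw [← mul_assoc, e1, sub_mul, mul_sub R, e1]
  simp only [mul_one, one_mul]
  module

lemma mem_of_commute (M : VonNeumannAlgebra H) (T : H →L[ℂ] H)
    (h : ∀ a ∈ M.commutant, a * T = T * a) : T ∈ M := by
  rw [← M.commutant_commutant, VonNeumannAlgebra.mem_commutant_iff]; exact h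

lemma comm_of_mem (M : VonNeumannAlgebra H) {T : H →L[ℂ] H} (hT : T ∈ M)
    {a : H →L[ℂ] H} (ha : a ∈ M.commutant) : T * a = a * T :=
  VonNeumannAlgebra.mem_commutant_iff.1 ha T hT

lemma inv_mem (M : VonNeumannAlgebra H) {S : H →L[ℂ] H} (hS : 0 ≤ S) (hM : S ∈ M) :
    Ring.inverse (1 + S) ∈ M := by
  apply mem_of_commute
  intro a ha
  have h1 : (1 + S) * a = a * (1 + S) := by
    rw [add_mul, mul_add, comm_of_mem M hM ha]; simp
  have h2 := inv_mul hS
  have h3 := mul_inv hS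
  calc a * Ring.inverse (1 + S) = Ring.inverse (1 + S) * ((1 + S) * a) * Ring.inverse (1 + S) := by
        rw [← mul_assoc, h2, one_mul]
    _ = Ring.inverse (1 + S) * a * ((1 + S) * Ring.inverse (1 + S)) := by
        rw [h1]; simp only [mul_assoc]
    _ = _ := by rw [h3, mul_one]

lemma smul_mem (M : VonNeumannAlgebra H) (c : ℝ) {S : H →L[ℂ] H} (hM : S ∈ M) :
    c • S ∈ M := by
  apply mem_of_commute
  intro a ha
  rw [mul_smul_comm, smul_mul_assoc, comm_of_mem M hM ha]

lemma sqrt_mem (M : VonNeumannAlgebra H) {S : H →L[ℂ] H} (hM : S ∈ M) :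
    CFC.sqrt S ∈ M := by
  apply mem_of_commute
  intro a ha
  have : Commute S a := comm_of_mem M hM ha
  exact (this.cfcₙ_nnreal NNReal.sqrt).eq.symm

lemma norm_sq_le {T : H →L[ℂ] H} (h0 : 0 ≤ T) (h1 : T ≤ 1) (ξ : H) :
    ‖T ξ‖ ^ 2 ≤ (⟪T ξ, ξ⟫_ℂ).re := by
  have hsa := IsSelfAdjoint.of_nonneg h0
  have : 0 ≤ T * (1 - T) := Commute.mul_nonneg h0 (sub_nonneg.2 h1)
    ((Commute.one_right _).sub_right (Commute.refl _))
  rw [ContinuousLinearMap.nonneg_iff_isPositive] at this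
  have h := this.re_inner_nonneg_left ξ
  have hs : ⟪T (T ξ), ξ⟫_ℂ = ⟪T ξ, T ξ⟫_ℂ := by
    have := ContinuousLinearMap.adjoint_inner_left T ξ (T ξ)
    rwa [← ContinuousLinearMap.star_eq_adjoint, hsa.star_eq] at this
  have e : (T * (1 - T)) ξ = T ξ - T (T ξ) := by simp
  rw [e, inner_sub_left, hs, inner_self_eq_norm_sq_to_K] at h
  simp only [map_sub] at h
  norm_cast at h
  simpa using h

lemma le_iff (S T : H →L[ℂ] H) (hS : IsSelfAdjoint S) (hT : IsSelfAdjoint T) :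
    S ≤ T ↔ ∀ ξ, (⟪S ξ, ξ⟫_ℂ).re ≤ (⟪T ξ, ξ⟫_ℂ).re := by
  rw [ContinuousLinearMap.le_def, ContinuousLinearMap.isPositive_def']
  simp [ContinuousLinearMap.reApplyInnerSelf_apply, inner_sub_left, hT.sub hS]

lemma re_mono {S T : H →L[ℂ] H} (h : S ≤ T) (ξ : H) :
    (⟪S ξ, ξ⟫_ℂ).re ≤ (⟪T ξ, ξ⟫_ℂ).re := by
  rw [ContinuousLinearMap.le_def] at h
  simpa [inner_sub_left] using h.re_inner_nonneg_left ξ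

/-- decreasing sequences of positive contractions converge strongly -/
lemma exists_lim (r : ℕ → H →L[ℂ] H) (hr : Antitone r) (h0 : ∀ n, 0 ≤ r n) (h1 : ∀ n, r n ≤ 1) :
    ∃ R : H →L[ℂ] H, ∀ ξ, Filter.Tendsto (fun n => r n ξ) Filter.atTop (nhds (R ξ)) := by
  have key : ∀ ξ, ∃ y, Filter.Tendsto (fun n => r n ξ) Filter.atTop (nhds y) := by
    intro ξ
    apply cauchySeq_tendsto_of_complete
    have hmono : Antitone fun n => (⟪r n ξ, ξ⟫_ℂ).re := fun a b h => re_mono (hr h) ξ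
    have hb : BddBelow (Set.range fun n => (⟪r n ξ, ξ⟫_ℂ).re) := by
      refine ⟨0, ?_⟩
      rintro _ ⟨n, rfl⟩
      simpa using re_mono (h0 n) ξ
    have hc : CauchySeq fun n => (⟪r n ξ, ξ⟫_ℂ).re :=
      (tendsto_atTop_ciInf hmono hb).cauchySeq
    rw [Metric.cauchySeq_iff'] at hc ⊢
    intro ε hε
    obtain ⟨N, hN⟩ := hc (ε ^ 2) (by positivity)
    refine ⟨N, fun n hn => ?_⟩
    have a1 := norm_sq_le (T := r N - r n) (sub_nonneg.2 (hr hn))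
      ((sub_le_self _ (h0 n)).trans (h1 N)) ξ
    have a2 := hN n hn
    rw [dist_comm, Real.dist_eq] at a2
    have a3 := (le_abs_self _).trans_lt a2
    rw [dist_comm, dist_eq_norm]
    simp only [sub_apply, inner_sub_left, Complex.sub_re] at a1
    have := a1.trans_lt a3
    exact lt_of_pow_lt_pow_left₀ 2 hε.le this
  choose f hf using key
  exact ⟨continuousLinearMapOfTendsto r (tendsto_pi_nhds.2 hf), hf⟩

lemma lim_mem (M : VonNeumannAlgebra H) (r : ℕ → H →L[ℂ] H) (hr : ∀ n, r n ∈ M) (R : H →L[ℂ] H)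
    (h : ∀ ξ, Filter.Tendsto (fun n => r n ξ) Filter.atTop (nhds (R ξ))) : R ∈ M := by
  apply mem_of_commute
  intro a ha
  ext ξ
  refine tendsto_nhds_unique ((a.continuous.tendsto _).comp (h ξ)) ((h (a ξ)).congr ?_)
  intro n
  exact congrArg (fun T : H →L[ℂ] H => T ξ) (comm_of_mem M (hr n) ha)

lemma lim_sa (r : ℕ → H →L[ℂ] H) (hr : ∀ n, IsSelfAdjoint (r n)) (R : H →L[ℂ] H)
    (h : ∀ ξ, Filter.Tendsto (fun n => r n ξ) Filter.atTop (nhds (R ξ))) : IsSelfAdjoint R := by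
  rw [ContinuousLinearMap.isSelfAdjoint_iff_isSymmetric]
  intro ξ η
  refine tendsto_nhds_unique ((h ξ).inner tendsto_const_nhds)
    ((tendsto_const_nhds.inner (h η)).congr ?_)
  intro n
  exact ((ContinuousLinearMap.isSelfAdjoint_iff_isSymmetric.1 (hr n)) ξ η).symm

lemma lim_re (r : ℕ → H →L[ℂ] H) (R : H →L[ℂ] H)
    (h : ∀ ξ, Filter.Tendsto (fun n => r n ξ) Filter.atTop (nhds (R ξ))) (ξ : H) :
    Filter.Tendsto (fun n => (⟪r n ξ, ξ⟫_ℂ).re) Filter.atTop (nhds (⟪R ξ, ξ⟫_ℂ).re) :=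
  (Complex.continuous_re.tendsto _).comp ((h ξ).inner tendsto_const_nhds)


/-- closed span of the orbit of `S` under the commutant -/
noncomputable def cyc (M : VonNeumannAlgebra H) (S : Set H) : Submodule ℂ H :=
  (Submodule.span ℂ {η | ∃ a ∈ M.commutant, ∃ ξ ∈ S, η = a ξ}).topologicalClosure

noncomputable instance (M : VonNeumannAlgebra H) (S : Set H) :
    (cyc M S).HasOrthogonalProjection := by
  have : CompleteSpace (cyc M S) :=
    (Submodule.isClosed_topologicalClosure _).completeSpace_coe
  infer_instance

lemma cyc_mono (M : VonNeumannAlgebra H) {S T : Set H} (h : S ⊆ T) : cyc M S ≤ cyc M T := by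
  apply Submodule.topologicalClosure_mono
  apply Submodule.span_mono
  rintro _ ⟨a, ha, ξ, hξ, rfl⟩
  exact ⟨a, ha, ξ, h hξ, rfl⟩

lemma subset_cyc (M : VonNeumannAlgebra H) {S : Set H} {ξ : H} (h : ξ ∈ S) : ξ ∈ cyc M S := by
  apply Submodule.le_topologicalClosure
  apply Submodule.subset_span
  exact ⟨1, one_mem _, ξ, h, by simp⟩

/-- induction principle for closed subspaces -/
lemma cyc_le (M : VonNeumannAlgebra H) {S : Set H} (V : Submodule ℂ H)
    (hV : IsClosed (V : Set H)) (h : ∀ a ∈ M.commutant, ∀ ξ ∈ S, a ξ ∈ V) : cyc M S ≤ V := by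
  apply Submodule.topologicalClosure_minimal _ _ hV
  rw [Submodule.span_le]
  rintro _ ⟨a, ha, ξ, hξ, rfl⟩
  exact h a ha ξ hξ

lemma cyc_inv (M : VonNeumannAlgebra H) {S : Set H} {a : H →L[ℂ] H} (ha : a ∈ M.commutant)
    {η : H} (hη : η ∈ cyc M S) : a η ∈ cyc M S := by
  have : cyc M S ≤ (cyc M S).comap a.toLinearMap := by
    apply cyc_le
    · exact (Submodule.isClosed_topologicalClosure _).preimage a.continuous
    · intro b hb ξ hξ
      apply Submodule.le_topologicalClosure
      apply Submodule.subset_span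
      exact ⟨a * b, mul_mem ha hb, ξ, hξ, by simp⟩
  exact this hη

lemma proj_mem (M : VonNeumannAlgebra H) (S : Set H) : (cyc M S).starProjection ∈ M := by
  have hp : IsStarProjection (cyc M S).starProjection := isStarProjection_starProjection
  rw [VonNeumannAlgebra.IsStarProjection.mem_iff hp]
  intro a ha
  rw [Module.End.mem_invtSubmodule_iff_forall_mem_of_mem]
  intro η hη
  rw [Submodule.range_starProjection] at hη ⊢
  exact cyc_inv M ha hη

lemma exists_sep (M : VonNeumannAlgebra H) (z : H →L[ℂ] H) (ψ : (H →L[ℂ] H) → ℝ≥0∞)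
    (hmono : ∀ S T, 0 ≤ S → S ≤ T → ψ S ≤ ψ T)
    (hadd : ∀ S T, 0 ≤ S → 0 ≤ T → ψ (S + T) = ψ S + ψ T)
    (hfin : ψ 1 < ∞) (hfaith : ∀ q ∈ M, IsStarProjection q → ψ q = 0 → q * z = 0) :
    ∃ S : Set H, S.Countable ∧ ∀ ζ, z ζ ∈ cyc M S := by
  have hpr : ∀ S, IsStarProjection (cyc M S).starProjection :=
    fun S => isStarProjection_starProjection
  have hp0 : ∀ S, 0 ≤ (cyc M S).starProjection := fun S => (hpr S).nonneg
  have hpm : ∀ S T : Set H, S ⊆ T → (cyc M S).starProjection ≤ (cyc M T).starProjection :=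
    fun S T h => Submodule.starProjection_le_starProjection_iff.2 (cyc_mono M h)
  set X : Set ℝ≥0∞ := {t | ∃ S : Set H, S.Countable ∧ t = ψ (cyc M S).starProjection} with hX
  have hXn : X.Nonempty := ⟨_, ∅, Set.countable_empty, rfl⟩
  obtain ⟨u, -, hu, huX⟩ := exists_seq_tendsto_sSup hXn (OrderTop.bddAbove X)
  choose S hS huS using huX
  have hUc : (⋃ n, S n).Countable := Set.countable_iUnion hS
  refine ⟨⋃ n, S n, hUc, ?_⟩
  have hmax : sSup X ≤ ψ (cyc M (⋃ n, S n)).starProjection := by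
    refine le_of_tendsto' hu fun n => ?_
    rw [huS]
    exact hmono _ _ (hp0 _) (hpm _ _ (Set.subset_iUnion S n))
  intro ζ
  by_contra hcon
  set U := ⋃ n, S n
  set p := (cyc M U).starProjection with hpdef
  set η := z ζ - p (z ζ) with hη
  set p' := (cyc M (insert η U)).starProjection with hp'def
  have hle : p ≤ p' := hpm _ _ (Set.subset_insert _ _)
  have h0 : ψ p' ∈ X := ⟨_, hUc.insert _, rfl⟩
  have h1 : ψ p' ≤ ψ p := (le_sSup h0).trans hmax
  have h2 : ψ p' = ψ p + ψ (p' - p) := by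
    rw [← hadd _ _ (hp0 _) (sub_nonneg.2 hle), add_sub_cancel]
  have hpf : ψ p ≠ ∞ := (hmono _ _ (hp0 _) (hpr U).le_one).trans_lt hfin |>.ne
  have h3 : ψ (p' - p) = 0 := by
    rw [h2] at h1
    have := (ENNReal.add_le_add_iff_left hpf).1 (h1.trans_eq (add_zero _).symm)
    simpa using this
  have hsp : IsStarProjection (p' - p) := ((hpr U).le_iff_sub (hpr _)).1 hle
  have h4 := hfaith (p' - p) (sub_mem (proj_mem M _) (proj_mem M _)) hsp h3
  have h5 : p' (z ζ) - p (z ζ) = 0 := by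
    have := congrArg (fun T : H →L[ℂ] H => T ζ) h4
    simpa using this
  have e1 : p' η = η := Submodule.starProjection_eq_self_iff.2 (subset_cyc M (Set.mem_insert _ _))
  have e2 : p' (p (z ζ)) = p (z ζ) := Submodule.starProjection_eq_self_iff.2
    (cyc_mono M (Set.subset_insert _ _) (Submodule.starProjection_apply_mem _ _))
  have e3 : p' η = p' (z ζ) - p (z ζ) := by rw [hη, map_sub, e2]
  rw [h5, e1, hη, sub_eq_zero] at e3
  apply hcon
  rw [e3]
  exact Submodule.starProjection_apply_mem _ _

lemma contr {T : H →L[ℂ] H} (h0 : 0 ≤ T) (h1 : T ≤ 1) (ξ : H) : ‖T ξ‖ ≤ ‖ξ‖ := by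
  have a := (norm_sq_le h0 h1 ξ).trans (re_mono h1 ξ)
  have e : (⟪(1 : H →L[ℂ] H) ξ, ξ⟫_ℂ).re = ‖ξ‖ ^ 2 := by
    simp only [one_apply_eq_self, inner_self_eq_norm_sq_to_K]
    norm_cast
  rw [e] at a
  exact le_of_sq_le_sq a (norm_nonneg _)

/-- the closed subspace where a sequence of positive contractions tends to zero strongly -/
lemma tend_cyc (M : VonNeumannAlgebra H) (T : ℕ → H →L[ℂ] H) (hM : ∀ n, T n ∈ M)
    (h0 : ∀ n, 0 ≤ T n) (h1 : ∀ n, T n ≤ 1) (S : Set H)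
    (hS : ∀ ξ ∈ S, Filter.Tendsto (fun n => T n ξ) Filter.atTop (nhds 0))
    (η : H) (hη : η ∈ cyc M S) :
    Filter.Tendsto (fun n => T n η) Filter.atTop (nhds 0) := by
  let V : Submodule ℂ H :=
    { carrier := {η | Filter.Tendsto (fun n => T n η) Filter.atTop (nhds 0)}
      add_mem' := by
        intro a b ha hb
        simpa using Filter.Tendsto.add ha hb
      zero_mem' := by simp
      smul_mem' := by
        intro c a ha
        simpa using Filter.Tendsto.const_smul ha c }
  have hV : IsClosed (V : Set H) := by
    rw [← closure_subset_iff_isClosed]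
    intro a ha
    rw [Metric.mem_closure_iff] at ha
    change Filter.Tendsto (fun n => T n a) Filter.atTop (nhds 0)
    rw [Metric.tendsto_atTop]
    intro ε hε
    obtain ⟨b, hb, hab⟩ := ha (ε / 2) (by positivity)
    obtain ⟨N, hN⟩ := Metric.tendsto_atTop.1
      (show Filter.Tendsto (fun n => T n b) Filter.atTop (nhds 0) from hb) (ε / 2) (by positivity)
    refine ⟨N, fun n hn => ?_⟩
    have h2 := hN n hn
    rw [dist_zero_right] at h2 ⊢
    have h3 := contr (h0 n) (h1 n) (a - b)
    rw [dist_eq_norm] at hab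
    have h4 : T n a = T n (a - b) + T n b := by simp
    rw [h4]
    linarith [norm_add_le (T n (a - b)) (T n b)]
  refine cyc_le M V hV ?_ hη
  intro a ha ξ hξ
  change Filter.Tendsto (fun n => T n (a ξ)) Filter.atTop (nhds 0)
  have h2 := (a.continuous.tendsto 0).comp (hS ξ hξ)
  rw [map_zero] at h2
  refine h2.congr fun n => ?_
  exact congrArg (fun T : H →L[ℂ] H => T ξ) (comm_of_mem M (hM n) ha).symm

lemma seq_exists (M : VonNeumannAlgebra H) (h : ℕ → H →L[ℂ] H) (hM : ∀ n, h n ∈ M)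
    (h0 : ∀ n, 0 ≤ h n) (h1 : ∀ n, h n ≤ 1) (f : ℕ → H)
    (hf : ∀ n, ∀ i ≤ n, (⟪h n (f i), f i⟫_ℂ).re ≤ (1/2 : ℝ) ^ n) :
    ∃ r : ℕ → H →L[ℂ] H, Monotone r ∧ (∀ n, r n ∈ M) ∧ (∀ n, 0 ≤ r n) ∧
      (∀ n, r n + (1/2 : ℝ) • h n ≤ 1) ∧
      ∀ i, Filter.Tendsto (fun n => (1 - r n) (f i)) Filter.atTop (nhds 0) := by
  set S : ℕ → ℕ → H →L[ℂ] H := fun m N => ∑ n ∈ Finset.Ico m N, h n with hSdef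
  have S0 : ∀ m N, 0 ≤ S m N := fun m N => Finset.sum_nonneg fun n _ => h0 n
  have SM : ∀ m N, S m N ∈ M := fun m N => sum_mem fun n _ => hM n
  have Smono : ∀ m, Monotone (S m) := fun m a b hab =>
    Finset.sum_le_sum_of_subset_of_nonneg (Finset.Ico_subset_Ico_right hab) fun n _ _ => h0 n
  have Santi : ∀ N m m', m ≤ m' → S m' N ≤ S m N := fun N m m' hab =>
    Finset.sum_le_sum_of_subset_of_nonneg (Finset.Ico_subset_Ico_left hab) fun n _ _ => h0 n
  set q : ℕ → ℕ → H →L[ℂ] H := fun m N => Ring.inverse (1 + S m N) with hq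
  have q0 : ∀ m N, 0 ≤ q m N := fun m N => inv_nonneg (S0 m N)
  have q1 : ∀ m N, q m N ≤ 1 := fun m N => by
    have := inv_anti le_rfl (S0 m N)
    simpa using this
  have qanti : ∀ m, Antitone (q m) := fun m a b hab => inv_anti (S0 m a) (Smono m hab)
  have qsa : ∀ m N, IsSelfAdjoint (q m N) := fun m N => IsSelfAdjoint.of_nonneg (q0 m N)
  choose r hr using fun m => exists_lim (q m) (qanti m) (q0 m) (q1 m)
  have rsa : ∀ m, IsSelfAdjoint (r m) := fun m => lim_sa _ (qsa m) _ (hr m)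
  have rle : ∀ m N, r m ≤ q m N := by
    intro m N
    rw [le_iff _ _ (rsa m) (qsa m N)]
    intro ξ
    refine le_of_tendsto (lim_re _ _ (hr m) ξ) ?_
    filter_upwards [Filter.eventually_ge_atTop N] with n hn
    exact re_mono (qanti m hn) ξ
  have r0 : ∀ m, 0 ≤ r m := by
    intro m
    rw [le_iff _ _ (IsSelfAdjoint.zero _) (rsa m)]
    intro ξ
    exact ge_of_tendsto' (lim_re _ _ (hr m) ξ) fun n => re_mono (q0 m n) ξ
  have rhalf : ∀ m, r m + (1/2 : ℝ) • h m ≤ 1 := by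
    intro m
    have a1 : q m (m + 1) + (1/2 : ℝ) • h m ≤ 1 := by
      simpa [hq, hSdef] using inv_le (h0 m) (h1 m)
    exact (add_le_add_left (rle m (m+1)) _).trans a1
  have r1 : ∀ m, r m ≤ 1 := fun m => (rle m 0).trans (q1 m 0)
  refine ⟨r, ?_, fun m => lim_mem M (q m) (fun N => inv_mem M (S0 m N) (SM m N)) _ (hr m), r0,
    rhalf, ?_⟩
  · intro a b hab
    rw [le_iff _ _ (rsa a) (rsa b)]
    intro ξ
    exact le_of_tendsto_of_tendsto' (lim_re _ _ (hr a) ξ) (lim_re _ _ (hr b) ξ)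
      fun N => re_mono (inv_anti (S0 b N) (Santi N a b hab)) ξ
  · intro i
    have bound : ∀ m, i ≤ m → ‖(1 - r m) (f i)‖ ^ 2 ≤ 2 * (1/2 : ℝ) ^ m := by
      intro m him
      refine (norm_sq_le (sub_nonneg.2 (r1 m)) (sub_le_self _ (r0 m)) (f i)).trans ?_
      have lim1 := (lim_re _ _ (hr m) (f i)).const_sub (⟪f i, f i⟫_ℂ).re
      have e : (⟪(1 - r m) (f i), f i⟫_ℂ).re = (⟪f i, f i⟫_ℂ).re - (⟪r m (f i), f i⟫_ℂ).re := by
        simp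
      rw [e]
      refine le_of_tendsto' lim1 fun N => ?_
      have a1 := re_mono (inv_ge (S0 m N)) (f i)
      have a2 : (⟪(1 - S m N) (f i), f i⟫_ℂ).re
          = (⟪f i, f i⟫_ℂ).re - ∑ n ∈ Finset.Ico m N, (⟪h n (f i), f i⟫_ℂ).re := by
        simp [hSdef]
      have a3 : ∑ n ∈ Finset.Ico m N, (⟪h n (f i), f i⟫_ℂ).re
          ≤ ∑ n ∈ Finset.Ico m N, (1/2 : ℝ) ^ n :=
        Finset.sum_le_sum fun n hn => hf n i (him.trans (Finset.mem_Ico.1 hn).1)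
      have a4 := geom_sum_Ico_le_of_lt_one (x := (1/2 : ℝ)) (m := m) (n := N) (by norm_num)
        (by norm_num)
      have a5 : (1/2 : ℝ) ^ m / (1 - 1/2) = 2 * (1/2 : ℝ) ^ m := by ring
      simp only [hq]
      linarith
    have l1 : Filter.Tendsto (fun m => ‖(1 - r m) (f i)‖ ^ 2) Filter.atTop (nhds 0) := by
      have l2 : Filter.Tendsto (fun m : ℕ => 2 * (1/2 : ℝ) ^ m) Filter.atTop (nhds 0) := by
        simpa using (tendsto_pow_atTop_nhds_zero_of_lt_one (r := (1/2 : ℝ)) (by norm_num)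
          (by norm_num)).const_mul 2
      refine tendsto_of_tendsto_of_tendsto_of_le_of_le' tendsto_const_nhds l2
        (Filter.Eventually.of_forall fun m => by positivity) ?_
      filter_upwards [Filter.eventually_ge_atTop i] with m hm using bound m hm
    rw [tendsto_zero_iff_norm_tendsto_zero]
    have := l1.sqrt
    simpa [Real.sqrt_sq] using this

lemma core (M : VonNeumannAlgebra H) (z : H →L[ℂ] H) (ψ : (H →L[ℂ] H) → ℝ≥0∞)
    (hmono : ∀ S T, 0 ≤ S → S ≤ T → ψ S ≤ ψ T)
    (hadd : ∀ S T, 0 ≤ S → 0 ≤ T → ψ (S + T) = ψ S + ψ T) (hzero : ψ 0 = 0)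
    (hfin : ψ 1 < ∞) (hfaith : ∀ q ∈ M, IsStarProjection q → ψ q = 0 → q * z = 0)
    (hnorm : ∀ r : ℕ → H →L[ℂ] H, Monotone r → (∀ n, r n ∈ M) → (∀ n, 0 ≤ r n) →
      (∀ n, r n ≤ 1) →
      (∀ ζ, Filter.Tendsto (fun n => r n (z ζ)) Filter.atTop (nhds (z ζ))) →
      ψ 1 ≤ ⨆ n, ψ (r n))
    {ι : Type*} (l : Filter ι)
    (x : ι → H →L[ℂ] H) (hxM : ∀ k, x k ∈ M)
    (hbdd : ∃ c : ℝ, ∀ k, ‖x k‖ ≤ c)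
    (hso : ∀ ξ : H, Filter.Tendsto (fun k => x k ξ) l (nhds 0)) :
    Filter.Tendsto (fun k => ψ (star (x k) * x k)) l (nhds 0) := by
  obtain ⟨c, hc⟩ := hbdd
  obtain ⟨N, hN⟩ := exists_nat_gt (c ^ 2)
  have hN0 : (0 : ℝ) < N := lt_of_le_of_lt (sq_nonneg c) hN
  set h : ι → H →L[ℂ] H := fun k => (1 / N : ℝ) • (star (x k) * x k) with hh
  have hxx0 : ∀ k, 0 ≤ star (x k) * x k := fun k => star_mul_self_nonneg _
  have h0 : ∀ k, 0 ≤ h k := fun k => smul_nonneg (by positivity) (hxx0 k)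
  have hM : ∀ k, h k ∈ M := fun k => smul_mem M _ (mul_mem (star_mem (hxM k)) (hxM k))
  have hnormle : ∀ k, ‖h k‖ ≤ 1 := by
    intro k
    have h2 : ‖star (x k) * x k‖ ≤ N := by
      rw [CStarRing.norm_star_mul_self]
      nlinarith [hc k, norm_nonneg (x k)]
    rw [hh]
    simp only [norm_smul]
    rw [Real.norm_of_nonneg (by positivity), one_div, inv_mul_le_iff₀ hN0]
    simpa using h2
  have h1 : ∀ k, h k ≤ 1 := fun k => (CStarAlgebra.norm_le_one_iff_of_nonneg _ (h0 k)).1 (hnormle k)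
  have hnsmul : ∀ (n : ℕ) (T : H →L[ℂ] H), 0 ≤ T → ψ (n • T) = n * ψ T := by
    intro n T hT
    induction n with
    | zero => simp [hzero]
    | succ n ih =>
      rw [succ_nsmul, hadd _ _ (nsmul_nonneg hT n) hT, ih]
      push_cast
      ring
  have hτ : Filter.Tendsto (fun k => ψ ((1/2 : ℝ) • h k)) l (nhds 0) := by
    obtain ⟨S, hSc, hS⟩ := exists_sep M z ψ hmono hadd hfin hfaith
    obtain ⟨f, hf⟩ := Set.countable_iff_exists_subset_range.1 hSc
    by_contra hcon
    rw [ENNReal.tendsto_nhds_zero] at hcon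
    push Not at hcon
    obtain ⟨ε, hε, hfreq⟩ := hcon
    have hpick : ∀ n : ℕ, ∃ k, ε < ψ ((1/2 : ℝ) • h k) ∧
        ∀ i ≤ n, (⟪h k (f i), f i⟫_ℂ).re ≤ (1/2 : ℝ) ^ n := by
      intro n
      have hev : ∀ᶠ k in l, ∀ i ∈ Finset.range (n + 1),
          (⟪h k (f i), f i⟫_ℂ).re ≤ (1/2 : ℝ) ^ n := by
        rw [Filter.eventually_all_finset]
        intro i _
        have l1 : Filter.Tendsto (fun k => (1 / N : ℝ) * ‖x k (f i)‖ ^ 2) l (nhds 0) := by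
          simpa using ((hso (f i)).norm.pow 2).const_mul (1 / N : ℝ)
        filter_upwards [l1.eventually_le_const (show (0:ℝ) < (1/2 : ℝ) ^ n by positivity)] with k hk
        refine le_of_eq_of_le ?_ hk
        rw [hh]
        have : ⟪(star (x k) * x k) (f i), f i⟫_ℂ = ((‖x k (f i)‖ ^ 2 : ℝ) : ℂ) := by
          rw [ContinuousLinearMap.mul_apply, ContinuousLinearMap.star_eq_adjoint,
            ContinuousLinearMap.adjoint_inner_left, inner_self_eq_norm_sq_to_K]
          norm_cast
        simp only [ContinuousLinearMap.smul_apply, real_inner_smul_left]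
        rw [← Complex.coe_smul, inner_smul_left, this, Complex.conj_ofReal, ← Complex.ofReal_mul,
          Complex.ofReal_re]
      obtain ⟨k, hk1, hk2⟩ := (hfreq.and_eventually hev).exists
      exact ⟨k, hk1, fun i hi => hk2 i (Finset.mem_range.2 (by omega))⟩
    choose k hk1 hk2 using hpick
    obtain ⟨r, rmono, rM, r0, rhalf, rlim⟩ := seq_exists M (fun n => h (k n)) (fun n => hM _)
      (fun n => h0 _) (fun n => h1 _) f hk2
    have hh0 : ∀ n, 0 ≤ (1/2 : ℝ) • h (k n) := fun n => smul_nonneg (by norm_num) (h0 _)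
    have r1 : ∀ n, r n ≤ 1 := fun n => (le_add_of_nonneg_right (hh0 n)).trans (rhalf n)
    have hlim : ∀ ζ, Filter.Tendsto (fun n => r n (z ζ)) Filter.atTop (nhds (z ζ)) := by
      intro ζ
      have := tend_cyc M (fun n => 1 - r n) (fun n => sub_mem (one_mem _) (rM n))
        (fun n => sub_nonneg.2 (r1 n)) (fun n => sub_le_self _ (r0 n)) S (by
          intro ξ hξ
          obtain ⟨i, rfl⟩ := hf hξ
          exact rlim i) (z ζ) (hS ζ)
      have := this.const_sub (z ζ)
      simpa using this
    have hsup := hnorm r rmono rM r0 r1 hlim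
    have hle : ∀ n, ψ (r n) + ε ≤ ψ 1 := fun n => by
      calc ψ (r n) + ε ≤ ψ (r n) + ψ ((1/2 : ℝ) • h (k n)) := by gcongr; exact (hk1 n).le
        _ = ψ (r n + (1/2 : ℝ) • h (k n)) := (hadd _ _ (r0 n) (hh0 n)).symm
        _ ≤ ψ 1 := hmono _ _ (add_nonneg (r0 n) (hh0 n)) (rhalf n)
    have hle2 : (⨆ n, ψ (r n)) + ε ≤ ψ 1 := by
      rw [ENNReal.iSup_add]
      exact iSup_le hle
    have : ψ 1 + ε ≤ ψ 1 + 0 := by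
      rw [add_zero]; exact (add_le_add_left hsup ε).trans hle2
    have := (ENNReal.add_le_add_iff_left hfin.ne).1 this
    exact absurd hε (not_lt.2 this)
  have hfinal : ∀ k, ψ (star (x k) * x k) = ((2 * N : ℕ) : ℝ≥0∞) * ψ ((1/2 : ℝ) • h k) := by
    intro k
    rw [← hnsmul _ _ (smul_nonneg (by norm_num) (h0 k))]
    congr 1
    rw [hh, ← Nat.cast_smul_eq_nsmul ℝ, smul_smul, smul_smul]
    push_cast
    rw [show (2 * N * (1/2) * (1 / N) : ℝ) = 1 by field_simp, one_smul]
  simp only [hfinal]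
  simpa using ENNReal.Tendsto.const_mul hτ (Or.inr (ENNReal.natCast_ne_top (2 * N)))

end S19

/-- Lemma 2.4 of the paper: Let `M` be a von Neumann algebra on `H`, `P ⊆ M` a
finite von Neumann subalgebra with a normal faithful conditional expectation `E : M → P`, and
`Tr` a normal semifinite faithful trace on `P` whose restriction to the center `Z(P)` is still
semifinite; put `φ = Tr ∘ E`.  If `(x_k)` is a bounded net in `M` converging strongly to `0`,
then for every projection `z ∈ Z(P)` with `Tr z < ∞`,
`sup_{a ∈ (P)₁} φ(z a* x_k* x_k a z) → 0`. -/
theorem stmt19 {H : Type*} [NormedAddCommGroup H] [InnerProductSpace ℂ H] [CompleteSpace H]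
    (M P : VonNeumannAlgebra H) (hPM : ∀ a : H →L[ℂ] H, a ∈ P → a ∈ M)
    (E : (H →L[ℂ] H) →ₗ[ℂ] (H →L[ℂ] H))
    (hErange : ∀ x ∈ M, E x ∈ P) (hEfix : ∀ a ∈ P, E a = a)
    (hEpos : ∀ x : H →L[ℂ] H, 0 ≤ x → 0 ≤ E x)
    (hEbimod : ∀ a ∈ P, ∀ b ∈ P, ∀ x ∈ M, E (a * x * b) = a * E x * b)
    (hEnormal : ∀ (ι : Type) [SemilatticeSup ι] [Nonempty ι] (p : ι → H →L[ℂ] H)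
      (x : H →L[ℂ] H), Monotone p → (∀ i, p i ∈ M) → x ∈ M →
      IsLUB (Set.range p) x → IsLUB (Set.range fun i => E (p i)) (E x))
    (hEfaithful : ∀ x ∈ M, 0 ≤ x → E x = 0 → x = 0)
    (Tr : (H →L[ℂ] H) → ℝ≥0∞)
    (hTr0 : Tr 0 = 0)
    (hTradd : ∀ S T : H →L[ℂ] H, 0 ≤ S → 0 ≤ T → Tr (S + T) = Tr S + Tr T)
    (hTrmono : ∀ S T : H →L[ℂ] H, 0 ≤ S → S ≤ T → Tr S ≤ Tr T)
    (hTrace : ∀ a ∈ P, Tr (star a * a) = Tr (a * star a))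
    (hTrfaithful : ∀ y ∈ P, 0 ≤ y → Tr y = 0 → y = 0)
    (hTrsemifinite : ∀ y ∈ P, 0 ≤ y → y ≠ 0 →
      ∃ y', y' ∈ P ∧ 0 ≤ y' ∧ y' ≤ y ∧ y' ≠ 0 ∧ Tr y' < ∞)
    (hTrcenter : ∀ z : H →L[ℂ] H, z ∈ P → (∀ a ∈ P, z * a = a * z) →
      IsIdempotentElem z → IsSelfAdjoint z → z ≠ 0 →
      ∃ z' : H →L[ℂ] H, z' ∈ P ∧ (∀ a ∈ P, z' * a = a * z') ∧ IsIdempotentElem z' ∧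
        IsSelfAdjoint z' ∧ z' ≤ z ∧ z' ≠ 0 ∧ Tr z' < ∞)
    (hTrnormal : ∀ (ι : Type) [SemilatticeSup ι] [Nonempty ι] (p : ι → H →L[ℂ] H)
      (x : H →L[ℂ] H), Monotone p → (∀ i, 0 ≤ p i ∧ p i ∈ P) → x ∈ P →
      IsLUB (Set.range p) x → Tr x = ⨆ i, Tr (p i))
    {ι : Type*} (l : Filter ι) [l.NeBot]
    (x : ι → H →L[ℂ] H) (hxM : ∀ k, x k ∈ M)
    (hbdd : ∃ c : ℝ, ∀ k, ‖x k‖ ≤ c)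
    (hso : ∀ ξ : H, Filter.Tendsto (fun k => x k ξ) l (nhds 0))
    (z : H →L[ℂ] H) (hzP : z ∈ P) (hzc : ∀ a ∈ P, z * a = a * z)
    (hz_idem : IsIdempotentElem z) (hz_sa : IsSelfAdjoint z)
    (hz_fin : Tr z < ∞) :
    Filter.Tendsto
      (fun k => ⨆ a : {a : H →L[ℂ] H // a ∈ P ∧ ‖a‖ ≤ 1},
        Tr (E (z * star a.1 * star (x k) * x k * a.1 * z))) l (nhds 0) := by
  have hzz : z * z = z := hz_idem
  have hzs : star z = z := hz_sa
  have hconj : ∀ T : H →L[ℂ] H, 0 ≤ T → 0 ≤ z * T * z := by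
    intro T hT
    have := star_left_conjugate_nonneg hT z
    rwa [hzs] at this
  have hconj2 : ∀ S T : H →L[ℂ] H, S ≤ T → z * S * z ≤ z * T * z := by
    intro S T hT
    have := hconj _ (sub_nonneg.2 hT)
    rwa [mul_sub, sub_mul, sub_nonneg] at this
  have hEmono : ∀ S T : H →L[ℂ] H, S ≤ T → E S ≤ E T := by
    intro S T hT
    have := hEpos _ (sub_nonneg.2 hT)
    rwa [map_sub, sub_nonneg] at this
  have hzM : z ∈ M := hPM z hzP
  have hψ := S19.core M z (fun T => Tr (E (z * T * z)))
    (fun S T h0 hST => hTrmono _ _ (hEpos _ (hconj _ h0)) (hEmono _ _ (hconj2 _ _ hST)))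
    (fun S T h0 h1 => by
      simp only [mul_add, add_mul, map_add]
      exact hTradd _ _ (hEpos _ (hconj _ h0)) (hEpos _ (hconj _ h1)))
    (by simpa using hTr0)
    (by simpa [hzz, hEfix z hzP] using hz_fin)
    (by
      intro q hq hqp h0
      have hm : z * q * z ∈ M := mul_mem (mul_mem hzM hq) hzM
      have e1 := hTrfaithful _ (hErange _ hm) (hEpos _ (hconj _ hqp.nonneg)) h0
      have e2 := hEfaithful _ hm (hconj _ hqp.nonneg) e1
      have e3 : star (q * z) * (q * z) = 0 := by
        rw [star_mul, hzs, hqp.isSelfAdjoint.star_eq, ← e2]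
        simp only [mul_assoc]
        rw [← mul_assoc q q z, hqp.isIdempotentElem.eq]
      exact CStarRing.star_mul_self_eq_zero_iff _ |>.1 e3)
    (by
      intro r hr hrM hr0 hr1 hlim
      have hlub : IsLUB (Set.range fun n => z * r n * z) z := by
        constructor
        · rintro _ ⟨n, rfl⟩
          have := hconj2 _ _ (hr1 n)
          simpa [hzz] using this
        · intro B hB
          have hB' : ∀ n, z * r n * z ≤ B := fun n => hB ⟨n, rfl⟩
          have hBsa : IsSelfAdjoint B := IsSelfAdjoint.of_nonneg
            ((hconj _ (hr0 0)).trans (hB' 0))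
          rw [S19.le_iff _ _ hz_sa hBsa]
          intro ξ
          have hl : ∀ ξ, Filter.Tendsto (fun n => (z * r n * z) ξ) Filter.atTop (nhds (z ξ)) := by
            intro ξ
            have := (z.continuous.tendsto _).comp (hlim ξ)
            have e : z (z ξ) = z ξ := congrArg (fun T : H →L[ℂ] H => T ξ) hzz
            rw [e] at this
            exact this
          exact le_of_tendsto' (S19.lim_re _ _ hl ξ) fun n => S19.re_mono (hB' n) ξ
      have hpm : Monotone fun n => z * r n * z := fun a b hab => hconj2 _ _ (hr hab)
      have hpM : ∀ n, z * r n * z ∈ M := fun n => mul_mem (mul_mem hzM (hrM n)) hzM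
      have h1 := hEnormal ℕ (fun n => z * r n * z) z hpm hpM hzM hlub
      rw [hEfix z hzP] at h1
      have h2 := hTrnormal ℕ (fun n => E (z * r n * z)) z (fun a b hab => hEmono _ _ (hpm hab))
        (fun n => ⟨hEpos _ (hconj _ (hr0 n)), hErange _ (hpM n)⟩) hzP h1
      simp only [mul_one, hzz, hEfix z hzP]
      exact h2.le)
    l x hxM hbdd hso
  refine tendsto_of_tendsto_of_tendsto_of_le_of_le tendsto_const_nhds hψ (fun k => zero_le) ?_
  intro k
  refine iSup_le ?_
  rintro ⟨a, haP, ha1⟩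
  have hxxM : star (x k) * x k ∈ M := mul_mem (star_mem (hxM k)) (hxM k)
  set y := E (star (x k) * x k) with hy
  have hy0 : 0 ≤ y := hEpos _ (star_mul_self_nonneg _)
  have hyP : y ∈ P := hErange _ hxxM
  set s := CFC.sqrt y with hs
  have hsP : s ∈ P := S19.sqrt_mem P hyP
  have hss : s * s = y := CFC.sqrt_mul_sqrt_self y hy0
  have hsstar : star s = s := (IsSelfAdjoint.of_nonneg (CFC.sqrt_nonneg y)).star_eq
  have hazP : a * z ∈ P := mul_mem haP hzP
  have hzaP : z * star a ∈ P := mul_mem hzP (star_mem haP)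
  have e1 : E (z * star a * star (x k) * x k * a * z) = star (s * (a * z)) * (s * (a * z)) := by
    have := hEbimod _ hzaP _ hazP _ hxxM
    rw [star_mul, star_mul, hzs, hsstar]
    calc _ = E (z * star a * (star (x k) * x k) * (a * z)) := by simp only [mul_assoc]
      _ = _ := by rw [this, ← hy, ← hss]; simp only [mul_assoc]
  have e2 : E (z * (star (x k) * x k) * z) = star (s * z) * (s * z) := by
    rw [hEbimod _ hzP _ hzP _ hxxM, ← hy, ← hss, star_mul, hzs, hsstar]
    simp only [mul_assoc]
  have haa : a * star a ≤ 1 := by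
    refine (CStarAlgebra.norm_le_one_iff_of_nonneg _ (mul_star_self_nonneg a)).1 ?_
    rw [CStarRing.norm_self_mul_star]
    exact mul_le_one₀ ha1 (norm_nonneg _) ha1
  change Tr (E (z * star a * star (x k) * x k * a * z)) ≤ Tr (E (z * (star (x k) * x k) * z))
  rw [e1, e2, hTrace _ (mul_mem hsP hazP), hTrace _ (mul_mem hsP hzP)]
  refine hTrmono _ _ (mul_star_self_nonneg _) ?_
  have f1 : s * (a * z) * star (s * (a * z)) = star (z * s) * (a * star a) * (z * s) := by
    rw [star_mul, star_mul, star_mul, hzs, hsstar, ← hzc a haP]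
    simp only [mul_assoc]
    rw [← mul_assoc z (star a) s, hzc _ (star_mem haP), mul_assoc]
  have f2 : s * z * star (s * z) = star (z * s) * 1 * (z * s) := by
    rw [star_mul, star_mul, hzs, hsstar, mul_one]
  rw [f1, f2]
  exact star_left_conjugate_le_conjugate haa _
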